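/- arXiv:1312.4550 — 3 statements merged into one kernel-verified Lean document; each statement's English description precedes it below -/
import Mathlib

section
/- Let d ≥ 1 and let u : ℤ^d → ℝ be harmonic on all of ℤ^d. For s ∈ S define u_s(x) := u(x+s) − u(x), and for a finite sequence s_1, …, s_k ∈ S define u_{s_1 s_2 … s_k} by iterating this operation. Then for every k ∈ ℕ and every x ∈ ℤ^d, (Δ^k (u²))(x) = (1/(2d)^k) Σ_{s_1, …, s_k ∈ S} (u_{s_1 s_2 … s_k}(x))². -/
/-- The standard generators of `ℤ^d`: `±e_i`, indexed by `Fin d × Bool`. -/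
def latticeGen (d : ℕ) (s : Fin d × Bool) : Fin d → ℤ :=
  fun j => if s.1 = j then (if s.2 then 1 else -1) else 0

/-- The averaging operator `(A f)(x) = (1/(2d)) ∑_{s ∈ S} f(x+s)`. -/
noncomputable def latticeAvg (d : ℕ) (f : (Fin d → ℤ) → ℝ) : (Fin d → ℤ) → ℝ :=
  fun x => (1 / (2 * (d : ℝ))) * ∑ s : Fin d × Bool, f (x + latticeGen d s)

/-- The discrete Laplacian `Δf = Af − f`. -/
noncomputable def latticeLap (d : ℕ) (f : (Fin d → ℤ) → ℝ) : (Fin d → ℤ) → ℝ :=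
  fun x => latticeAvg d f x - f x

/-- The growth function `Q_u(n) = (Aⁿ (u²))(0)`. -/
noncomputable def growthQ (d : ℕ) (u : (Fin d → ℤ) → ℝ) (n : ℕ) : ℝ :=
  (latticeAvg d)^[n] (fun y => (u y) ^ 2) 0

/-- Forward difference of a function on `ℕ`. -/
def fdiff (g : ℕ → ℝ) : ℕ → ℝ := fun n => g (n + 1) - g n

/-- The difference operator `u_s(x) = u(x+s) − u(x)` in the direction of generator `s`. -/
def dirDiff (d : ℕ) (s : Fin d × Bool) (u : (Fin d → ℤ) → ℝ) : (Fin d → ℤ) → ℝ :=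
  fun x => u (x + latticeGen d s) - u x

/-- Iterated difference `u_{s_1 s_2 … s_k}` along a finite sequence of generators. -/
def iterDirDiff (d : ℕ) : ∀ {k : ℕ}, (Fin k → Fin d × Bool) → ((Fin d → ℤ) → ℝ) → ((Fin d → ℤ) → ℝ)
  | 0, _, u => u
  | k + 1, s, u => dirDiff d (s 0) (iterDirDiff d (fun i : Fin k => s i.succ) u)

lemma latticeLap_dirDiff_eq_zero (d : ℕ) (s : Fin d × Bool) {v : (Fin d → ℤ) → ℝ}
    (hv : ∀ x, latticeLap d v x = 0) (x : Fin d → ℤ) :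
    latticeLap d (dirDiff d s v) x = 0 := by
  have h₁ := hv (x + latticeGen d s)
  have h₂ := hv x
  simp only [latticeLap, latticeAvg, dirDiff, Finset.sum_sub_distrib,
    add_right_comm x _ (latticeGen d s)] at *
  linarith

lemma latticeLap_iterDirDiff_eq_zero (d : ℕ) {u : (Fin d → ℤ) → ℝ}
    (hu : ∀ x, latticeLap d u x = 0) {k : ℕ} (s : Fin k → Fin d × Bool) (x : Fin d → ℤ) :
    latticeLap d (iterDirDiff d s u) x = 0 := by
  induction k generalizing x with
  | zero => exact hu x
  | succ k ih => exact latticeLap_dirDiff_eq_zero d (s 0) (ih fun i => s i.succ) x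

lemma latticeLap_sq {d : ℕ} (hd : 1 ≤ d) {v : (Fin d → ℤ) → ℝ}
    (hv : ∀ x, latticeLap d v x = 0) (x : Fin d → ℤ) :
    latticeLap d (fun y => (v y) ^ 2) x
      = (1 / (2 * (d : ℝ))) * ∑ s : Fin d × Bool, (dirDiff d s v x) ^ 2 := by
  have hd' : (d : ℝ) ≠ 0 := by positivity
  have hx := hv x
  simp only [latticeLap, latticeAvg, dirDiff, sub_sq, Finset.sum_add_distrib,
    Finset.sum_sub_distrib, ← Finset.sum_mul, ← Finset.mul_sum, Finset.sum_const,
    Finset.card_univ, Fintype.card_prod, Fintype.card_fin, Fintype.card_bool, nsmul_eq_mul,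
    Nat.cast_mul, Nat.cast_ofNat] at *
  field_simp at *
  linear_combination (2 * v x) * hx

lemma latticeLap_const_mul_sum (d : ℕ) {ι : Type*} [Fintype ι] (c : ℝ)
    (f : ι → (Fin d → ℤ) → ℝ) (x : Fin d → ℤ) :
    latticeLap d (fun y => c * ∑ i, f i y) x = c * ∑ i, latticeLap d (f i) x := by
  simp only [latticeLap, latticeAvg, Finset.sum_sub_distrib, ← Finset.mul_sum]
  rw [Finset.sum_comm]
  ring

theorem stmt_3 (d : ℕ) (hd : 1 ≤ d) (u : (Fin d → ℤ) → ℝ)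
    (hu : ∀ x, latticeLap d u x = 0) :
    ∀ (k : ℕ) (x : Fin d → ℤ),
      (latticeLap d)^[k] (fun y => (u y) ^ 2) x
        = (1 / (2 * (d : ℝ)) ^ k) *
            ∑ s : Fin k → Fin d × Bool, (iterDirDiff d s u x) ^ 2 := by
  intro k
  induction k with
  | zero => intro x; simp [iterDirDiff]
  | succ k ih =>
    intro x
    rw [Function.iterate_succ_apply', funext ih, latticeLap_const_mul_sum]
    simp only [fun s : Fin k → Fin d × Bool =>
      latticeLap_sq hd (latticeLap_iterDirDiff_eq_zero d hu s) x]
    rw [← Finset.mul_sum, ← mul_assoc, ← (Fin.consEquiv fun _ => Fin d × Bool).sum_comp,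
      Fintype.sum_prod_type, Finset.sum_comm]
    simp only [iterDirDiff, Fin.consEquiv_apply, Fin.cons_zero, Fin.cons_succ]
    congr 1
    rw [pow_succ]
    ring
end

section
/- Let d ≥ 2, R > 0, and let u be a harmonic function on the open Euclidean ball B(0,R) ⊂ ℝ^d. Define q_u : [0,R) → ℝ by q_u(r) = ∫_{S^{d−1}} u(rω)² dσ(ω), where σ is the normalized (total mass one) surface measure on the unit sphere S^{d−1} ⊂ ℝ^d. Then q_u is absolutely monotonic on [0,R): q_u is infinitely differentiable there and for every k ∈ ℕ and every r ∈ [0,R), the k-th derivative satisfies q_u^{(k)}(r) ≥ 0. -/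
open MeasureTheory Metric

/-- The Euclidean Laplacian on `EuclideanSpace ℝ (Fin d)`: `Δf(x) = ∑_i ∂²f/∂x_i²(x)`, where the
second partial derivative in direction `e_i` is the second derivative at `0` of `t ↦ f(x + t·e_i)`. -/
noncomputable def eLap (d : ℕ) (f : EuclideanSpace ℝ (Fin d) → ℝ) :
    EuclideanSpace ℝ (Fin d) → ℝ :=
  fun x => ∑ i : Fin d, iteratedDeriv 2 (fun t : ℝ => f (x + t • EuclideanSpace.single i (1 : ℝ))) 0

/-- The rotation-invariant probability measure on the unit sphere of `ℝ^d`, obtained by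
normalizing the surface measure induced by Lebesgue measure. -/
noncomputable def sphereProb (d : ℕ) : Measure (sphere (0 : EuclideanSpace ℝ (Fin d)) 1) :=
  ((volume : Measure (EuclideanSpace ℝ (Fin d))).toSphere Set.univ)⁻¹ •
    (volume : Measure (EuclideanSpace ℝ (Fin d))).toSphere

/-- Agmon's `L²` growth function `q_u(r) = ∫_{S^{d−1}} u(rω)² dσ(ω)`. -/
noncomputable def agmonQ (d : ℕ) (u : EuclideanSpace ℝ (Fin d) → ℝ) (r : ℝ) : ℝ :=
  ∫ ω : sphere (0 : EuclideanSpace ℝ (Fin d)) 1,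
    (u (r • (ω : EuclideanSpace ℝ (Fin d)))) ^ 2 ∂(sphereProb d)

instance isFiniteMeasure_sphereProb (d : ℕ) : IsFiniteMeasure (sphereProb d) where
  measure_univ_lt_top := by
    rw [sphereProb, Measure.smul_apply, smul_eq_mul]
    exact (ENNReal.inv_mul_le_one _).trans_lt ENNReal.one_lt_top

theorem Continuous.integrable_of_compactSpace {X : Type*} [TopologicalSpace X] [CompactSpace X]
    [MeasurableSpace X] [OpensMeasurableSpace X] {μ : Measure X} [IsFiniteMeasure μ] {f : X → ℝ}
    (hf : Continuous f) : Integrable f μ :=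
  hf.integrable_of_hasCompactSupport (HasCompactSupport.of_compactSpace f)

/-- Differentiation under the integral sign over a compact space. -/
theorem hasDerivAt_integral_of_compactSpace {X : Type*} [TopologicalSpace X] [CompactSpace X]
    [MeasurableSpace X] [OpensMeasurableSpace X] {μ : Measure X} [IsFiniteMeasure μ]
    {F F' : ℝ → X → ℝ} (hF : ∀ t, Continuous (F t)) (hF' : Continuous (Function.uncurry F'))
    (h : ∀ t x, HasDerivAt (fun s => F s x) (F' t x) t) (t : ℝ) :
    HasDerivAt (fun s => ∫ x, F s x ∂μ) (∫ x, F' t x ∂μ) t := by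
  obtain ⟨C, hC⟩ := ((isCompact_closedBall t 1).prod
    (isCompact_univ (X := X))).exists_bound_of_continuousOn hF'.continuousOn
  refine (hasDerivAt_integral_of_dominated_loc_of_deriv_le (bound := fun _ => C)
    (closedBall_mem_nhds t one_pos)
    (.of_forall fun s => (hF s).integrable_of_compactSpace.aestronglyMeasurable)
    (hF t).integrable_of_compactSpace
    (Continuous.integrable_of_compactSpace (by fun_prop)).aestronglyMeasurable
    (.of_forall fun x s hs => hC (s, x) ⟨hs, Set.mem_univ x⟩) (integrable_const C)
    (.of_forall fun x s _ => h s x)).2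

/-- The action of a linear isometry equivalence on the unit sphere. -/
def LinearIsometryEquiv.sphereMap {E : Type*} [NormedAddCommGroup E] [NormedSpace ℝ E]
    (g : E ≃ₗᵢ[ℝ] E) (ω : sphere (0 : E) 1) : sphere (0 : E) 1 :=
  ⟨g ω, by simp⟩

theorem LinearIsometryEquiv.continuous_sphereMap {E : Type*} [NormedAddCommGroup E]
    [NormedSpace ℝ E] (g : E ≃ₗᵢ[ℝ] E) : Continuous g.sphereMap := by
  unfold LinearIsometryEquiv.sphereMap
  fun_prop

open scoped Pointwise in
theorem LinearIsometryEquiv.measurePreserving_sphereMap_toSphere {E : Type*}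
    [NormedAddCommGroup E] [InnerProductSpace ℝ E] [FiniteDimensional ℝ E] [MeasurableSpace E]
    [BorelSpace E] (g : E ≃ₗᵢ[ℝ] E) :
    MeasurePreserving g.sphereMap (volume : Measure E).toSphere (volume : Measure E).toSphere := by
  refine ⟨g.continuous_sphereMap.measurable, Measure.ext fun s hs => ?_⟩
  rw [Measure.map_apply g.continuous_sphereMap.measurable hs, Measure.toSphere_apply' _ hs,
    Measure.toSphere_apply' _ (g.continuous_sphereMap.measurable hs),
    ← g.measurePreserving.measure_preimage_emb g.toHomeomorph.measurableEmbedding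
      (Set.Ioo (0 : ℝ) 1 • Set.image Subtype.val s)]
  congr 2
  ext x
  simp only [Set.mem_smul, Set.mem_preimage, Set.mem_image]
  constructor
  · rintro ⟨c, hc, _, ⟨ω, hω, rfl⟩, rfl⟩
    exact ⟨c, hc, g ω, ⟨g.sphereMap ω, hω, rfl⟩, (g.map_smul c (ω : E)).symm⟩
  · rintro ⟨c, hc, _, ⟨ω, hω, rfl⟩, h⟩
    have h1 : g.sphereMap (g.symm.sphereMap ω) = ω :=
      Subtype.ext (g.apply_symm_apply (ω : E))
    refine ⟨c, hc, g.symm ω, ⟨g.symm.sphereMap ω, by rwa [h1], rfl⟩, ?_⟩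
    apply g.injective
    rw [g.map_smul, g.apply_symm_apply, h]

theorem integral_sphereProb_sphereMap {d : ℕ}
    (g : EuclideanSpace ℝ (Fin d) ≃ₗᵢ[ℝ] EuclideanSpace ℝ (Fin d))
    {f : sphere (0 : EuclideanSpace ℝ (Fin d)) 1 → ℝ} (hf : Continuous f) :
    ∫ ω, f (g.sphereMap ω) ∂sphereProb d = ∫ ω, f ω ∂sphereProb d := by
  have h := (g.measurePreserving_sphereMap_toSphere).smul_measure
    ((volume : Measure (EuclideanSpace ℝ (Fin d))).toSphere Set.univ)⁻¹
  rw [sphereProb, ← integral_map h.measurable.aemeasurable (by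
    rw [h.map_eq]
    exact hf.measurable.aestronglyMeasurable), h.map_eq]

/-- The infinitesimal rotation `x ↦ x_i e_j - x_j e_i`. -/
noncomputable def rotationGenerator {d : ℕ} (i j : Fin d) :
    EuclideanSpace ℝ (Fin d) →L[ℝ] EuclideanSpace ℝ (Fin d) :=
  (EuclideanSpace.proj i : EuclideanSpace ℝ (Fin d) →L[ℝ] ℝ).smulRight
      (EuclideanSpace.single j (1 : ℝ)) -
    (EuclideanSpace.proj j : EuclideanSpace ℝ (Fin d) →L[ℝ] ℝ).smulRight
      (EuclideanSpace.single i (1 : ℝ))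

theorem rotationGenerator_apply {d : ℕ} (i j : Fin d) (x : EuclideanSpace ℝ (Fin d)) :
    rotationGenerator i j x =
      x i • EuclideanSpace.single j (1 : ℝ) - x j • EuclideanSpace.single i (1 : ℝ) := by
  simp [rotationGenerator]

theorem rotationGenerator_mem_skewAdjoint {d : ℕ} (i j : Fin d) :
    rotationGenerator i j ∈
      skewAdjoint (EuclideanSpace ℝ (Fin d) →L[ℝ] EuclideanSpace ℝ (Fin d)) := by
  rw [skewAdjoint.mem_iff, eq_comm, ContinuousLinearMap.star_eq_adjoint,
    ContinuousLinearMap.eq_adjoint_iff]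
  intro x y
  simp only [neg_apply, rotationGenerator_apply, inner_neg_left,
    inner_sub_left, inner_sub_right, real_inner_smul_left, real_inner_smul_right,
    EuclideanSpace.inner_single_left, EuclideanSpace.inner_single_right]
  simp
  ring

/-- The integral over the sphere of the derivative along an infinitesimal rotation vanishes. -/
theorem integral_fderiv_skewAdjoint {d : ℕ} {w : EuclideanSpace ℝ (Fin d) → ℝ}
    (hw : ContDiff ℝ 1 w) {A : EuclideanSpace ℝ (Fin d) →L[ℝ] EuclideanSpace ℝ (Fin d)}
    (hA : A ∈ skewAdjoint (EuclideanSpace ℝ (Fin d) →L[ℝ] EuclideanSpace ℝ (Fin d))) :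
    ∫ ω : sphere (0 : EuclideanSpace ℝ (Fin d)) 1, fderiv ℝ w ω (A ω) ∂sphereProb d = 0 := by
  let +nondep : NormedAlgebra ℚ (EuclideanSpace ℝ (Fin d) →L[ℝ] EuclideanSpace ℝ (Fin d)) :=
    .restrictScalars ℚ ℝ _
  have hexp : Continuous fun t : ℝ => NormedSpace.exp (t • A) :=
    continuous_iff_continuousAt.2 fun t => (hasDerivAt_exp_smul_const' A t).continuousAt
  have hD := hasDerivAt_integral_of_compactSpace (μ := sphereProb d)
    (F := fun t ω => w (NormedSpace.exp (t • A) ω))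
    (F' := fun t ω => fderiv ℝ w (NormedSpace.exp (t • A) ω) ((A * NormedSpace.exp (t • A)) ω))
    (fun t => hw.continuous.comp (by fun_prop))
    (by
      have h1 : Continuous (fderiv ℝ w) := hw.continuous_fderiv one_ne_zero
      have h2 : Continuous fun p : ℝ × sphere (0 : EuclideanSpace ℝ (Fin d)) 1 =>
          NormedSpace.exp (p.1 • A) p.2 :=
        (hexp.comp continuous_fst).clm_apply (continuous_subtype_val.comp continuous_snd)
      exact (h1.comp h2).clm_apply (A.continuous.comp h2))
    (fun t ω => ((hw.differentiable one_ne_zero _).hasFDerivAt).comp_hasDerivAt t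
      ((hasDerivAt_exp_smul_const' A t).clm_apply (hasDerivAt_const t _) |>.congr_deriv (by simp))) 0
  have hconst : (fun t : ℝ => ∫ ω : sphere (0 : EuclideanSpace ℝ (Fin d)) 1,
      w (NormedSpace.exp (t • A) ω) ∂sphereProb d) =
      fun _ => ∫ ω : sphere (0 : EuclideanSpace ℝ (Fin d)) 1, w ω ∂sphereProb d := by
    funext t
    exact integral_sphereProb_sphereMap (Unitary.linearIsometryEquiv
      ⟨_, NormedSpace.exp_mem_unitary_of_mem_skewAdjoint (skewAdjoint.smul_mem t hA)⟩)
      (f := fun ω => w ω) (hw.continuous.comp continuous_subtype_val)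
  rw [hconst] at hD
  have h0 : NormedSpace.exp ((0 : ℝ) • A) = 1 := by
    rw [zero_smul ℝ A, NormedSpace.exp_zero]
  simpa [h0] using hD.unique (hasDerivAt_const _ _)

/-- The partial derivative `∂f/∂x_i` on `EuclideanSpace ℝ (Fin d)`. -/
noncomputable def partialDeriv {d : ℕ} (i : Fin d) (f : EuclideanSpace ℝ (Fin d) → ℝ)
    (x : EuclideanSpace ℝ (Fin d)) : ℝ :=
  fderiv ℝ f x (EuclideanSpace.single i 1)

section partialDeriv

variable {d : ℕ} {f g : EuclideanSpace ℝ (Fin d) → ℝ}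

theorem ContDiff.partialDeriv (hf : ContDiff ℝ (⊤ : ℕ∞) f) (i : Fin d) :
    ContDiff ℝ (⊤ : ℕ∞) (partialDeriv i f) :=
  (hf.fderiv_right (m := (⊤ : ℕ∞)) (by simp)).clm_apply contDiff_const

theorem fderiv_eq_sum_partialDeriv (x v : EuclideanSpace ℝ (Fin d)) :
    fderiv ℝ f x v = ∑ i, v i * partialDeriv i f x := by
  conv_lhs => rw [← (EuclideanSpace.basisFun (Fin d) ℝ).sum_repr v]
  simp [partialDeriv]

theorem partialDeriv_comm (hf : ContDiff ℝ (⊤ : ℕ∞) f) (i j : Fin d) (x : EuclideanSpace ℝ (Fin d)) :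
    partialDeriv i (partialDeriv j f) x = partialDeriv j (partialDeriv i f) x := by
  have hd : DifferentiableAt ℝ (fderiv ℝ f) x :=
    (hf.fderiv_right (m := (⊤ : ℕ∞)) (by simp)).differentiable (by simp) x
  have h (k l : Fin d) : partialDeriv k (partialDeriv l f) x =
      fderiv ℝ (fderiv ℝ f) x (EuclideanSpace.single k 1) (EuclideanSpace.single l 1) := by
    rw [partialDeriv]
    unfold partialDeriv
    rw [fderiv_clm_apply hd (differentiableAt_const _)]
    simp
  rw [h, h]
  exact hf.contDiffAt.isSymmSndFDerivAt
    (by simpa using WithTop.coe_le_coe.2 (le_top : (2 : ℕ∞) ≤ ⊤)) _ _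

theorem partialDeriv_mul (hf : ContDiff ℝ (⊤ : ℕ∞) f) (hg : ContDiff ℝ (⊤ : ℕ∞) g) (i : Fin d)
    (x : EuclideanSpace ℝ (Fin d)) :
    partialDeriv i (fun y => f y * g y) x = f x * partialDeriv i g x + g x * partialDeriv i f x := by
  rw [partialDeriv, fderiv_fun_mul (hf.differentiable (by simp) x) (hg.differentiable (by simp) x)]
  simp [partialDeriv]

theorem partialDeriv_add (hf : ContDiff ℝ (⊤ : ℕ∞) f) (hg : ContDiff ℝ (⊤ : ℕ∞) g) (i : Fin d)
    (x : EuclideanSpace ℝ (Fin d)) :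
    partialDeriv i (fun y => f y + g y) x = partialDeriv i f x + partialDeriv i g x := by
  rw [partialDeriv, fderiv_fun_add (hf.differentiable (by simp) x) (hg.differentiable (by simp) x)]
  simp [partialDeriv]

theorem partialDeriv_sum {ι : Type*} (s : Finset ι) {F : ι → EuclideanSpace ℝ (Fin d) → ℝ}
    (hF : ∀ k, ContDiff ℝ (⊤ : ℕ∞) (F k)) (i : Fin d) (x : EuclideanSpace ℝ (Fin d)) :
    partialDeriv i (fun y => ∑ k ∈ s, F k y) x = ∑ k ∈ s, partialDeriv i (F k) x := by
  rw [partialDeriv, fderiv_fun_sum fun k _ => (hF k).differentiable (by simp) x]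
  simp [partialDeriv]

theorem hasDerivAt_comp_line (hf : ContDiff ℝ (⊤ : ℕ∞) f) (x v : EuclideanSpace ℝ (Fin d)) (t : ℝ) :
    HasDerivAt (fun t : ℝ => f (x + t • v)) (fderiv ℝ f (x + t • v) v) t :=
  (hf.differentiable (by simp) _).hasFDerivAt.comp_hasDerivAt t
    (by simpa using ((hasDerivAt_id t).smul_const v).const_add x)

theorem eLap_eq_sum_partialDeriv (hf : ContDiff ℝ (⊤ : ℕ∞) f) (x : EuclideanSpace ℝ (Fin d)) :
    eLap d f x = ∑ i, partialDeriv i (partialDeriv i f) x := by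
  refine Finset.sum_congr rfl fun i _ => ?_
  have h (f : EuclideanSpace ℝ (Fin d) → ℝ) (hf : ContDiff ℝ (⊤ : ℕ∞) f) :
      deriv (fun t : ℝ => f (x + t • EuclideanSpace.single i (1 : ℝ))) =
        fun t => partialDeriv i f (x + t • EuclideanSpace.single i (1 : ℝ)) :=
    funext fun t => (hasDerivAt_comp_line hf x _ t).deriv
  rw [iteratedDeriv_succ, iteratedDeriv_one, h f hf, h _ (hf.partialDeriv i)]
  simp

theorem eLap_partialDeriv (hf : ContDiff ℝ (⊤ : ℕ∞) f) (j : Fin d) (x : EuclideanSpace ℝ (Fin d)) :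
    eLap d (partialDeriv j f) x = partialDeriv j (eLap d f) x := by
  rw [eLap_eq_sum_partialDeriv (hf.partialDeriv j), funext (eLap_eq_sum_partialDeriv hf),
    partialDeriv_sum _ fun i => (hf.partialDeriv i).partialDeriv i]
  refine Finset.sum_congr rfl fun i _ => ?_
  rw [funext (partialDeriv_comm hf i j), partialDeriv_comm (hf.partialDeriv i)]

theorem eLap_sq (hf : ContDiff ℝ (⊤ : ℕ∞) f) (x : EuclideanSpace ℝ (Fin d)) :
    eLap d (fun y => f y ^ 2) x = 2 * ∑ i, partialDeriv i f x ^ 2 + 2 * f x * eLap d f x := by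
  rw [eLap_eq_sum_partialDeriv (hf.pow 2), eLap_eq_sum_partialDeriv hf, Finset.mul_sum,
    Finset.mul_sum, ← Finset.sum_add_distrib]
  refine Finset.sum_congr rfl fun i _ => ?_
  have hi := hf.partialDeriv i
  simp_rw [sq, funext (partialDeriv_mul hf hf i),
    partialDeriv_add (hf.mul hi) (hf.mul hi), partialDeriv_mul hf hi]
  ring

end partialDeriv

/-- The weighted spherical mean `r ↦ ∫ g(ω) v(rω) dσ(ω)`. -/
noncomputable def sphereMean {d : ℕ} (g : sphere (0 : EuclideanSpace ℝ (Fin d)) 1 → ℝ)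
    (v : EuclideanSpace ℝ (Fin d) → ℝ) (r : ℝ) : ℝ :=
  ∫ ω, g ω * v (r • (ω : EuclideanSpace ℝ (Fin d))) ∂sphereProb d

section sphereMean

variable {d : ℕ} {g : sphere (0 : EuclideanSpace ℝ (Fin d)) 1 → ℝ}
  {v : EuclideanSpace ℝ (Fin d) → ℝ}

theorem integrable_sphereMean (hg : Continuous g) (hv : Continuous v) (r : ℝ) :
    Integrable (fun ω => g ω * v (r • (ω : EuclideanSpace ℝ (Fin d)))) (sphereProb d) :=
  Continuous.integrable_of_compactSpace (by fun_prop)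

theorem hasDerivAt_sphereMean (hg : Continuous g) (hv : ContDiff ℝ (⊤ : ℕ∞) v) (r : ℝ) :
    HasDerivAt (sphereMean g v)
      (∑ i, sphereMean (fun ω => g ω * (ω : EuclideanSpace ℝ (Fin d)) i) (partialDeriv i v) r)
      r := by
  have hc (i : Fin d) : Continuous fun ω : sphere (0 : EuclideanSpace ℝ (Fin d)) 1 =>
      (ω : EuclideanSpace ℝ (Fin d)) i := by fun_prop
  have hv' (i : Fin d) : Continuous (partialDeriv i v) := (hv.partialDeriv i).continuous
  have hvc := hv.continuous
  unfold sphereMean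
  rw [← integral_finsetSum _ fun i _ => integrable_sphereMean
    (g := fun ω => g ω * (ω : EuclideanSpace ℝ (Fin d)) i) (hg.mul (hc i)) (hv' i) r]
  refine hasDerivAt_integral_of_compactSpace
    (F := fun r ω => g ω * v (r • (ω : EuclideanSpace ℝ (Fin d))))
    (F' := fun r ω => ∑ i, g ω * (ω : EuclideanSpace ℝ (Fin d)) i *
      partialDeriv i v (r • (ω : EuclideanSpace ℝ (Fin d))))
    (fun t => by fun_prop) ?_ (fun t ω => ?_) r
  · unfold Function.uncurry
    fun_prop
  · have h := (hasDerivAt_comp_line hv 0 (ω : EuclideanSpace ℝ (Fin d)) t).const_mul (g ω)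
    simp only [zero_add] at h
    rw [fderiv_eq_sum_partialDeriv, Finset.mul_sum] at h
    simpa only [mul_assoc] using h

theorem contDiff_sphereMean (hg : Continuous g) (hv : ContDiff ℝ (⊤ : ℕ∞) v) :
    ContDiff ℝ (⊤ : ℕ∞) (sphereMean g v) := by
  rw [contDiff_infty]
  intro n
  induction n generalizing g v with
  | zero =>
    exact contDiff_zero.2 (continuous_iff_continuousAt.2 fun r =>
      (hasDerivAt_sphereMean hg hv r).continuousAt)
  | succ n ih =>
    push_cast
    refine contDiff_succ_iff_deriv.2
      ⟨fun r => (hasDerivAt_sphereMean hg hv r).differentiableAt, by simp, ?_⟩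
    rw [funext fun r => (hasDerivAt_sphereMean hg hv r).deriv]
    exact ContDiff.sum fun i _ => ih (by fun_prop) (hv.partialDeriv i)

theorem integral_rotation_partialDeriv (hv : ContDiff ℝ (⊤ : ℕ∞) v) (r : ℝ) (i j : Fin d) :
    ∫ ω : sphere (0 : EuclideanSpace ℝ (Fin d)) 1,
      (((if i = j then ω.1 i else 0) - ω.1 j) * partialDeriv j v (r • ω.1) +
        r * (ω.1 i ^ 2 * partialDeriv j (partialDeriv j v) (r • ω.1) -
          ω.1 i * ω.1 j * partialDeriv i (partialDeriv j v) (r • ω.1))) ∂sphereProb d = 0 := by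
  have hp := hv.partialDeriv j
  have hcomp : ContDiff ℝ (⊤ : ℕ∞) fun x : EuclideanSpace ℝ (Fin d) => partialDeriv j v (r • x) :=
    hp.comp (contDiff_const_smul r)
  have hcoord : ContDiff ℝ (⊤ : ℕ∞) fun x : EuclideanSpace ℝ (Fin d) => x i := by fun_prop
  refine Eq.trans (integral_congr_ae (.of_forall fun ω => ?_))
    (integral_fderiv_skewAdjoint (w := fun x => x i * partialDeriv j v (r • x))
      ((hcoord.mul hcomp).of_le (by simp)) (rotationGenerator_mem_skewAdjoint i j))
  have h1 : HasFDerivAt (fun x : EuclideanSpace ℝ (Fin d) => x i)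
      (EuclideanSpace.proj i : EuclideanSpace ℝ (Fin d) →L[ℝ] ℝ) ω.1 :=
    (EuclideanSpace.proj i : EuclideanSpace ℝ (Fin d) →L[ℝ] ℝ).hasFDerivAt
  have h2 : HasFDerivAt (fun x : EuclideanSpace ℝ (Fin d) => partialDeriv j v (r • x))
      ((fderiv ℝ (partialDeriv j v) (r • ω.1)).comp
        (r • ContinuousLinearMap.id ℝ (EuclideanSpace ℝ (Fin d)))) ω.1 :=
    (hp.differentiable (by simp) (r • ω.1)).hasFDerivAt.comp ω.1
      ((hasFDerivAt_id ω.1).const_smul r)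
  simp only [(h1.fun_mul h2).fderiv, rotationGenerator_apply]
  have h3 (k : Fin d) : fderiv ℝ (partialDeriv j v) (r • ω.1) (EuclideanSpace.single k 1) =
    partialDeriv k (partialDeriv j v) (r • ω.1) := rfl
  simp [h3]
  split_ifs <;> ring

/-- The Euler–Poisson–Darboux equation for spherical means of a smooth function. -/
theorem sphereMean_euler_poisson_darboux (hv : ContDiff ℝ (⊤ : ℕ∞) v) (r : ℝ) :
    r * deriv (deriv (sphereMean (fun _ => 1) v)) r +
      (d - 1 : ℝ) * deriv (sphereMean (fun _ => 1) v) r =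
      r * sphereMean (fun _ => 1) (eLap d v) r := by
  have hv1 (i : Fin d) : Continuous (partialDeriv i v) := (hv.partialDeriv i).continuous
  have hv2 (i j : Fin d) : Continuous (partialDeriv i (partialDeriv j v)) :=
    ((hv.partialDeriv j).partialDeriv i).continuous
  have hd1 : deriv (sphereMean (fun _ => 1) v) = fun r => ∑ i,
      sphereMean (fun ω => 1 * (ω : EuclideanSpace ℝ (Fin d)) i) (partialDeriv i v) r :=
    funext fun r => (hasDerivAt_sphereMean continuous_const hv r).deriv
  have hd2 := (HasDerivAt.fun_sum (u := Finset.univ) fun i _ => hasDerivAt_sphereMean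
    (g := fun ω => 1 * (ω : EuclideanSpace ℝ (Fin d)) i) (by fun_prop) (hv.partialDeriv i) r).deriv
  have hA : Continuous fun ω : sphere (0 : EuclideanSpace ℝ (Fin d)) 1 =>
      ∑ i, ∑ j, 1 * ω.1 i * ω.1 j * partialDeriv j (partialDeriv i v) (r • ω.1) := by fun_prop
  have hB : Continuous fun ω : sphere (0 : EuclideanSpace ℝ (Fin d)) 1 =>
      ∑ i, 1 * ω.1 i * partialDeriv i v (r • ω.1) := by fun_prop
  have hL : Continuous fun ω : sphere (0 : EuclideanSpace ℝ (Fin d)) 1 =>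
      1 * ∑ i, partialDeriv i (partialDeriv i v) (r • ω.1) := by fun_prop
  have hRot (i j : Fin d) : Continuous fun ω : sphere (0 : EuclideanSpace ℝ (Fin d)) 1 =>
      ((if i = j then ω.1 i else 0) - ω.1 j) * partialDeriv j v (r • ω.1) +
        r * (ω.1 i ^ 2 * partialDeriv j (partialDeriv j v) (r • ω.1) -
          ω.1 i * ω.1 j * partialDeriv i (partialDeriv j v) (r • ω.1)) := by
    split_ifs <;> fun_prop
  rw [hd1, hd2]
  unfold sphereMean
  simp_rw [funext (eLap_eq_sum_partialDeriv hv)]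
  have hAint : ∑ i, ∑ j, ∫ ω : sphere (0 : EuclideanSpace ℝ (Fin d)) 1,
      1 * ω.1 i * ω.1 j * partialDeriv j (partialDeriv i v) (r • ω.1) ∂sphereProb d =
      ∫ ω : sphere (0 : EuclideanSpace ℝ (Fin d)) 1, ∑ i, ∑ j,
        1 * ω.1 i * ω.1 j * partialDeriv j (partialDeriv i v) (r • ω.1) ∂sphereProb d := by
    rw [integral_finsetSum _ fun i _ => Continuous.integrable_of_compactSpace (by fun_prop)]
    exact Finset.sum_congr rfl fun i _ => (integral_finsetSum _ fun j _ =>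
      Continuous.integrable_of_compactSpace (by fun_prop)).symm
  rw [hAint, ← integral_finsetSum _ fun i _ => Continuous.integrable_of_compactSpace (by fun_prop),
    ← integral_const_mul, ← integral_const_mul, ← integral_const_mul,
    ← integral_add (hA.integrable_of_compactSpace.const_mul _)
      (hB.integrable_of_compactSpace.const_mul _), ← sub_eq_zero,
    ← integral_sub (Continuous.integrable_of_compactSpace (by fun_prop))
      (hL.integrable_of_compactSpace.const_mul _)]
  have hrot : ∫ ω : sphere (0 : EuclideanSpace ℝ (Fin d)) 1, -∑ i, ∑ j,
      (((if i = j then ω.1 i else 0) - ω.1 j) * partialDeriv j v (r • ω.1) +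
        r * (ω.1 i ^ 2 * partialDeriv j (partialDeriv j v) (r • ω.1) -
          ω.1 i * ω.1 j * partialDeriv i (partialDeriv j v) (r • ω.1))) ∂sphereProb d = 0 := by
    rw [integral_neg, integral_finsetSum _ fun i _ => (continuous_finsetSum _ fun j _ =>
      hRot i j).integrable_of_compactSpace, neg_eq_zero]
    refine Finset.sum_eq_zero fun i _ => ?_
    rw [integral_finsetSum _ fun j _ => (hRot i j).integrable_of_compactSpace]
    exact Finset.sum_eq_zero fun j _ => integral_rotation_partialDeriv hv r i j
  refine Eq.trans ?_ hrot
  congr 1 with ω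
  have hω : ∑ i, ω.1 i ^ 2 = 1 := by
    rw [← EuclideanSpace.real_norm_sq_eq, norm_eq_of_mem_sphere, one_pow]
  have hcomm (i j : Fin d) := partialDeriv_comm hv i j (r • ω.1)
  simp only [one_mul, Finset.sum_add_distrib, sub_mul, ite_mul, zero_mul, Finset.sum_sub_distrib,
    ← Finset.mul_sum, ← Finset.sum_mul, hω, Finset.sum_ite_eq, Finset.mem_univ, if_true,
    Finset.sum_const, Finset.card_univ, Fintype.card_fin, nsmul_eq_mul, hcomm]
  ring

end sphereMean

section absolutelyMonotonic

theorem ContDiff.iteratedDeriv_of_top {f : ℝ → ℝ} (hf : ContDiff ℝ (⊤ : ℕ∞) f) (k : ℕ) :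
    ContDiff ℝ (⊤ : ℕ∞) (iteratedDeriv k f) := by
  rw [iteratedDeriv_eq_iterate]
  exact hf.iterate_deriv k

theorem ContDiff.hasDerivAt_iteratedDeriv {f : ℝ → ℝ} (hf : ContDiff ℝ (⊤ : ℕ∞) f) (k : ℕ)
    (r : ℝ) : HasDerivAt (iteratedDeriv k f) (iteratedDeriv (k + 1) f r) r := by
  rw [iteratedDeriv_succ]
  exact ((hf.iteratedDeriv_of_top k).differentiable (by simp) r).hasDerivAt

/-- Differentiating the equation `r q'' + m q' = r G` repeatedly. -/
theorem iteratedDeriv_euler_poisson_darboux {q G : ℝ → ℝ} (hq : ContDiff ℝ (⊤ : ℕ∞) q)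
    (hG : ContDiff ℝ (⊤ : ℕ∞) G) {m ρ : ℝ}
    (h : ∀ r ∈ Set.Ioo (-ρ) ρ, r * deriv (deriv q) r + m * deriv q r = r * G r) (k : ℕ) :
    ∀ r ∈ Set.Ioo (-ρ) ρ, r * iteratedDeriv (k + 2) q r + (k + m) * iteratedDeriv (k + 1) q r =
      r * iteratedDeriv k G r + k * iteratedDeriv (k - 1) G r := by
  induction k with
  | zero =>
    intro r hr
    simpa [iteratedDeriv_succ, iteratedDeriv_one] using h r hr
  | succ k ih =>
    intro r hr
    have hL := ((hasDerivAt_id r).mul (hq.hasDerivAt_iteratedDeriv (k + 2) r)).add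
      ((hq.hasDerivAt_iteratedDeriv (k + 1) r).const_mul (k + m))
    have hR : HasDerivAt (fun r => r * iteratedDeriv k G r + k * iteratedDeriv (k - 1) G r)
        (1 * iteratedDeriv k G r + r * iteratedDeriv (k + 1) G r + k * iteratedDeriv k G r) r := by
      refine ((hasDerivAt_id r).mul (hG.hasDerivAt_iteratedDeriv k r)).add ?_
      rcases k with _ | k
      · simpa using hasDerivAt_const r (0 : ℝ)
      · exact (hG.hasDerivAt_iteratedDeriv k r).const_mul _
    have heq := hL.unique (hR.congr_of_eventuallyEq
      (Filter.eventually_of_mem (isOpen_Ioo.mem_nhds hr) ih))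
    dsimp only [id] at heq
    push_cast
    linarith

theorem nonneg_of_mul_deriv_add_nonneg {f : ℝ → ℝ} (hf : ContDiff ℝ 1 f) {n : ℕ}
    (hn : n ≠ 0) {ρ : ℝ} (h : ∀ r ∈ Set.Ico 0 ρ, 0 ≤ r * deriv f r + n * f r) :
    ∀ r ∈ Set.Ico 0 ρ, 0 ≤ f r := by
  intro r hr
  rcases hr.1.eq_or_lt with rfl | hr0
  · have := h 0 hr
    rw [zero_mul, zero_add] at this
    exact nonneg_of_mul_nonneg_right this (by positivity)
  have hderiv (s : ℝ) : HasDerivAt (fun s => s ^ n * f s)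
      (n * s ^ (n - 1) * f s + s ^ n * deriv f s) s :=
    (hasDerivAt_pow n s).mul (hf.differentiable one_ne_zero s).hasDerivAt
  have hmono : MonotoneOn (fun s => s ^ n * f s) (Set.Icc 0 r) := by
    refine monotoneOn_of_deriv_nonneg (convex_Icc 0 r)
      (fun s _ => (hderiv s).continuousAt.continuousWithinAt)
      (fun s _ => (hderiv s).differentiableAt.differentiableWithinAt) fun s hs => ?_
    rw [interior_Icc] at hs
    rw [(hderiv s).deriv]
    obtain ⟨n, rfl⟩ := Nat.exists_eq_succ_of_ne_zero hn
    have h1 := mul_nonneg (pow_nonneg hs.1.le n) (h s ⟨hs.1.le, hs.2.trans hr.2⟩)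
    simp only [Nat.succ_eq_add_one, Nat.add_sub_cancel, pow_succ] at h1 ⊢
    linarith
  have h0 := hmono ⟨le_rfl, hr.1⟩ ⟨hr.1, le_rfl⟩ hr.1
  simp only [zero_pow hn, zero_mul] at h0
  exact nonneg_of_mul_nonneg_right h0 (by positivity)

variable {d : ℕ} {u : EuclideanSpace ℝ (Fin d) → ℝ}

theorem agmonQ_eq_sphereMean (u : EuclideanSpace ℝ (Fin d) → ℝ) :
    agmonQ d u = sphereMean (fun _ => 1) fun x => u x ^ 2 := by
  funext r
  simp [agmonQ, sphereMean]

theorem contDiff_agmonQ (hu : ContDiff ℝ (⊤ : ℕ∞) u) : ContDiff ℝ (⊤ : ℕ∞) (agmonQ d u) := by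
  rw [agmonQ_eq_sphereMean]
  exact contDiff_sphereMean continuous_const (hu.pow 2)

theorem norm_smul_sphere (r : ℝ) (ω : sphere (0 : EuclideanSpace ℝ (Fin d)) 1) :
    ‖r • (ω : EuclideanSpace ℝ (Fin d))‖ = |r| := by
  simp [norm_smul]

theorem agmonQ_euler_poisson_darboux (hu : ContDiff ℝ (⊤ : ℕ∞) u) {ρ : ℝ}
    (hharm : ∀ x ∈ ball (0 : EuclideanSpace ℝ (Fin d)) ρ, eLap d u x = 0) :
    ∀ r ∈ Set.Ioo (-ρ) ρ, r * deriv (deriv (agmonQ d u)) r + (d - 1) * deriv (agmonQ d u) r =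
      r * ∑ i, 2 * agmonQ d (partialDeriv i u) r := by
  intro r hr
  rw [agmonQ_eq_sphereMean, sphereMean_euler_poisson_darboux (hu.pow 2)]
  congr 1
  unfold sphereMean agmonQ
  simp_rw [← integral_const_mul]
  have hp (i : Fin d) : Continuous (partialDeriv i u) := (hu.partialDeriv i).continuous
  rw [← integral_finsetSum _ fun i _ => Continuous.integrable_of_compactSpace (by fun_prop)]
  congr 1 with ω
  rw [eLap_sq hu, hharm _ (by
    rw [mem_ball_zero_iff, norm_smul_sphere]
    exact abs_lt.2 hr), Finset.mul_sum]
  ring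

theorem iteratedDeriv_agmonQ_nonneg (hd : 2 ≤ d) (hu : ContDiff ℝ (⊤ : ℕ∞) u) {ρ : ℝ}
    (hharm : ∀ x ∈ ball (0 : EuclideanSpace ℝ (Fin d)) ρ, eLap d u x = 0) (k : ℕ) :
    ∀ r ∈ Set.Ico 0 ρ, 0 ≤ iteratedDeriv k (agmonQ d u) r := by
  induction k using Nat.strong_induction_on generalizing u with
  | _ k ih =>
    rcases k with _ | k
    · intro r _
      rw [iteratedDeriv_zero]
      exact integral_nonneg fun ω => sq_nonneg _
    have hQ := contDiff_agmonQ hu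
    have hQi (i : Fin d) : ContDiff ℝ (⊤ : ℕ∞) fun r => 2 * agmonQ d (partialDeriv i u) r :=
      contDiff_const.mul (contDiff_agmonQ (hu.partialDeriv i))
    have hG : ContDiff ℝ (⊤ : ℕ∞) fun r => ∑ i, 2 * agmonQ d (partialDeriv i u) r :=
      ContDiff.sum fun i _ => hQi i
    have hharm' (i : Fin d) :
        ∀ x ∈ ball (0 : EuclideanSpace ℝ (Fin d)) ρ, eLap d (partialDeriv i u) x = 0 := by
      intro x hx
      have h0 : eLap d u =ᶠ[nhds x] fun _ => 0 :=
        Filter.eventually_of_mem (isOpen_ball.mem_nhds hx) hharm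
      rw [eLap_partialDeriv hu, partialDeriv, h0.fderiv_eq]
      simp
    have hGnonneg (j : ℕ) (hj : j < k + 1) (r : ℝ) (hr : r ∈ Set.Ico 0 ρ) :
        0 ≤ iteratedDeriv j (fun r => ∑ i, 2 * agmonQ d (partialDeriv i u) r) r := by
      rw [iteratedDeriv_fun_sum fun i _ => (hQi i).contDiffAt.of_le (by exact_mod_cast le_top)]
      refine Finset.sum_nonneg fun i _ => ?_
      rw [iteratedDeriv_const_mul_field]
      exact mul_nonneg two_pos.le (ih j hj (hu.partialDeriv i) (hharm' i) r hr)
    have hode := iteratedDeriv_euler_poisson_darboux hQ hG (agmonQ_euler_poisson_darboux hu hharm) k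
    refine nonneg_of_mul_deriv_add_nonneg (n := k + (d - 1))
      ((hQ.iteratedDeriv_of_top (k + 1)).of_le (by simp)) (by omega) fun r hr => ?_
    rw [← iteratedDeriv_succ]
    push_cast [Nat.cast_sub (show 1 ≤ d by omega)]
    rw [hode r ⟨by linarith [hr.1, hr.2], hr.2⟩]
    exact add_nonneg (mul_nonneg hr.1 (hGnonneg k (by omega) r hr))
      (mul_nonneg k.cast_nonneg (hGnonneg (k - 1) (by omega) r hr))

/-- A smooth function on a ball agrees on any smaller concentric ball with a smooth function on
the whole space. -/
theorem exists_contDiff_eqOn_ball {E : Type*} [NormedAddCommGroup E] [InnerProductSpace ℝ E]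
    [FiniteDimensional ℝ E] {f : E → ℝ} {R ρ : ℝ} (hρ : 0 < ρ) (hρR : ρ < R)
    (hf : ContDiffOn ℝ (⊤ : ℕ∞) f (ball 0 R)) :
    ∃ g : E → ℝ, ContDiff ℝ (⊤ : ℕ∞) g ∧ Set.EqOn g f (ball 0 ρ) := by
  obtain ⟨ρ', h1, h2⟩ := exists_between hρR
  let b : ContDiffBump (0 : E) := ⟨ρ, ρ', hρ, h1⟩
  refine ⟨fun x => b x * f x, contDiff_iff_contDiffAt.2 fun x => ?_, fun x hx => ?_⟩
  · by_cases hx : x ∈ ball (0 : E) R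
    · exact b.contDiffAt.mul (hf.contDiffAt (isOpen_ball.mem_nhds hx))
    · have hx' : x ∉ closedBall (0 : E) ρ' := fun h => hx (closedBall_subset_ball h2 h)
      refine (contDiffAt_const (c := (0 : ℝ))).congr_of_eventuallyEq ?_
      filter_upwards [isClosed_closedBall.isOpen_compl.mem_nhds hx'] with y hy
      rw [b.zero_of_le_dist (not_le.1 (mem_closedBall.not.1 hy)).le, zero_mul]
  · simp [b.one_of_mem_closedBall (ball_subset_closedBall hx)]

theorem eLap_congr {f g : EuclideanSpace ℝ (Fin d) → ℝ} {x : EuclideanSpace ℝ (Fin d)}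
    (h : f =ᶠ[nhds x] g) : eLap d f x = eLap d g x := by
  refine Finset.sum_congr rfl fun i _ => Filter.EventuallyEq.iteratedDeriv_eq 2 ?_
  have hc : Filter.Tendsto (fun t : ℝ => x + t • EuclideanSpace.single i (1 : ℝ)) (nhds 0)
      (nhds x) := by
    have : Continuous fun t : ℝ => x + t • EuclideanSpace.single i (1 : ℝ) := by fun_prop
    simpa using this.tendsto 0
  exact hc.eventually h

theorem agmonQ_congr {v : EuclideanSpace ℝ (Fin d) → ℝ} {ρ r : ℝ}
    (h : Set.EqOn v u (ball 0 ρ)) (hr : |r| < ρ) : agmonQ d v r = agmonQ d u r := by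
  unfold agmonQ
  congr 1 with ω
  rw [h (by rwa [mem_ball_zero_iff, norm_smul_sphere])]

end absolutelyMonotonic

theorem stmt_4 (d : ℕ) (hd : 2 ≤ d) (R : ℝ) (hR : 0 < R)
    (u : EuclideanSpace ℝ (Fin d) → ℝ)
    (hsmooth : ContDiffOn ℝ (⊤ : ℕ∞) u (ball (0 : EuclideanSpace ℝ (Fin d)) R))
    (hu : ∀ x ∈ ball (0 : EuclideanSpace ℝ (Fin d)) R, eLap d u x = 0) :
    ContDiffOn ℝ (⊤ : ℕ∞) (agmonQ d u) (Set.Ico 0 R) ∧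
    ∀ (k : ℕ), ∀ r ∈ Set.Ico (0 : ℝ) R,
      0 ≤ iteratedDerivWithin k (agmonQ d u) (Set.Ico 0 R) r := by
  have key (r : ℝ) (hr : r ∈ Set.Ico 0 R) : ContDiffAt ℝ (⊤ : ℕ∞) (agmonQ d u) r ∧
      ∀ k, 0 ≤ iteratedDeriv k (agmonQ d u) r := by
    obtain ⟨ρ, hrρ, hρR⟩ := exists_between hr.2
    obtain ⟨v, hv, hvu⟩ := exists_contDiff_eqOn_ball (hr.1.trans_lt hrρ) hρR hsmooth
    have heq : agmonQ d u =ᶠ[nhds r] agmonQ d v := by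
      filter_upwards [isOpen_Ioo.mem_nhds (⟨by linarith [hr.1], hrρ⟩ : r ∈ Set.Ioo (-ρ) ρ)]
        with s hs using (agmonQ_congr hvu (abs_lt.2 hs)).symm
    refine ⟨(contDiff_agmonQ hv).contDiffAt.congr_of_eventuallyEq heq, fun k => ?_⟩
    rw [heq.iteratedDeriv_eq]
    refine iteratedDeriv_agmonQ_nonneg hd hv (fun x hx => ?_) k r ⟨hr.1, hrρ⟩
    rw [eLap_congr (Filter.eventually_of_mem (isOpen_ball.mem_nhds hx) hvu)]
    exact hu x (ball_subset_ball hρR.le hx)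
  refine ⟨fun r hr => (key r hr).1.contDiffWithinAt, fun k r hr => ?_⟩
  rw [iteratedDerivWithin_eq_iteratedDeriv (uniqueDiffOn_Ico 0 R)
    ((key r hr).1.of_le (by exact_mod_cast le_top)) hr]
  exact (key r hr).2 k
end

section
/- Let d ≥ 1, M ∈ ℕ, and let u : ℤ^d → ℝ be harmonic on all of ℤ^d with polynomial growth of degree M, i.e. there are constants C, D > 0 such that |u(x)| ≤ C‖x‖^M + D for all x ∈ ℤ^d. Then u is the restriction to ℤ^d of a real polynomial in d variables of total degree at most M. -/
section LatticeGeometry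

variable {d : ℕ}

/-- The `ℓ¹`-norm on `ℤ^d`. -/
def latticeNorm (x : Fin d → ℤ) : ℤ := ∑ i, |x i|

lemma latticeNorm_nonneg (x : Fin d → ℤ) : 0 ≤ latticeNorm x :=
  Finset.sum_nonneg fun _ _ => abs_nonneg _

lemma latticeNorm_add_le (x y : Fin d → ℤ) :
    latticeNorm (x + y) ≤ latticeNorm x + latticeNorm y := by
  unfold latticeNorm
  rw [← Finset.sum_add_distrib]
  exact Finset.sum_le_sum fun i _ => abs_add_le _ _

lemma latticeNorm_latticeGen (s : Fin d × Bool) : latticeNorm (latticeGen d s) = 1 := by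
  unfold latticeNorm latticeGen
  rw [Finset.sum_eq_single s.1]
  · cases s.2 <;> simp
  · intro j _ hj
    simp [hj.symm]
  · simp

lemma latticeNorm_nsmul (n : ℕ) (x : Fin d → ℤ) : latticeNorm (n • x) = n * latticeNorm x := by
  simp [latticeNorm, abs_mul, Finset.mul_sum]

lemma update_add_latticeGen (x : Fin d → ℤ) (i : Fin d) (n : ℤ) :
    Function.update x i n + latticeGen d (i, true) = Function.update x i (n + 1) := by
  ext j
  rcases eq_or_ne i j with rfl | h
  · simp [latticeGen]
  · simp [latticeGen, h, h.symm]

lemma fwdDiff_iter_update (u : (Fin d → ℤ) → ℝ) (i : Fin d) (x : Fin d → ℤ) (k : ℕ) :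
    (fwdDiff (1 : ℤ))^[k] (fun n => u (Function.update x i n)) =
      fun n => (fwdDiff (latticeGen d (i, true)))^[k] u (Function.update x i n) := by
  induction k with
  | zero => rfl
  | succ k ih =>
    rw [Function.iterate_succ_apply', Function.iterate_succ_apply', ih]
    funext n
    simp only [fwdDiff, update_add_latticeGen]

lemma nonneg_of_abs_le_mul_latticeNorm {u : (Fin d → ℤ) → ℝ} {K : ℝ} {M : ℕ}
    (hK : ∀ x, |u x| ≤ K * (1 + (latticeNorm x : ℝ)) ^ M) : 0 ≤ K := by
  have := (abs_nonneg _).trans (hK 0)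
  simpa [latticeNorm] using this

end LatticeGeometry

section Averaging

variable {d : ℕ}

/-- The averaging operator as a linear map. -/
noncomputable def latticeAvgLin (d : ℕ) : Module.End ℝ ((Fin d → ℤ) → ℝ) where
  toFun := latticeAvg d
  map_add' f g := by
    funext x
    simp [latticeAvg, Finset.sum_add_distrib, mul_add]
  map_smul' c f := by
    funext x
    simp only [latticeAvg, Pi.smul_apply, smul_eq_mul, ← Finset.mul_sum, RingHom.id_apply]
    ring

lemma latticeAvg_iterate (n : ℕ) (f : (Fin d → ℤ) → ℝ) :
    (latticeAvg d)^[n] f = (latticeAvgLin d ^ n) f := by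
  rw [Module.End.pow_apply]
  rfl

lemma latticeAvg_iterate_nonneg {f : (Fin d → ℤ) → ℝ} (hf : ∀ x, 0 ≤ f x) (n : ℕ)
    (x : Fin d → ℤ) : 0 ≤ (latticeAvg d)^[n] f x := by
  induction n generalizing x with
  | zero => exact hf x
  | succ n ih =>
    rw [Function.iterate_succ_apply']
    exact mul_nonneg (by positivity) (Finset.sum_nonneg fun s _ => ih _)

lemma latticeAvg_le (hd : 1 ≤ d) {f : (Fin d → ℤ) → ℝ} {x : Fin d → ℤ} {b : ℝ}
    (hf : ∀ s, f (x + latticeGen d s) ≤ b) : latticeAvg d f x ≤ b := by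
  have hd' : (0 : ℝ) < d := by exact_mod_cast hd
  calc latticeAvg d f x ≤ (1 / (2 * (d : ℝ))) * ∑ _s : Fin d × Bool, b :=
        mul_le_mul_of_nonneg_left (Finset.sum_le_sum fun s _ => hf s) (by positivity)
    _ = b := by
        simp
        field_simp

lemma latticeAvg_iterate_le (hd : 1 ≤ d) {f : (Fin d → ℤ) → ℝ} {b : ℝ} (n : ℕ)
    (x : Fin d → ℤ) (hf : ∀ y, latticeNorm y ≤ latticeNorm x + n → f y ≤ b) :
    (latticeAvg d)^[n] f x ≤ b := by
  induction n generalizing x with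
  | zero => exact hf x (by simp)
  | succ n ih =>
    rw [Function.iterate_succ_apply']
    refine latticeAvg_le hd fun s => ih _ fun y hy => hf y ?_
    have := latticeNorm_add_le x (latticeGen d s)
    rw [latticeNorm_latticeGen] at this
    push_cast
    linarith

lemma latticeLap_comp_add {u : (Fin d → ℤ) → ℝ} (hu : ∀ x, latticeLap d u x = 0)
    (a x : Fin d → ℤ) : latticeLap d (fun y => u (y + a)) x = 0 := by
  rw [← hu (x + a)]
  simp only [latticeLap, latticeAvg, add_right_comm]

lemma latticeLap_fwdDiff {u : (Fin d → ℤ) → ℝ} (hu : ∀ x, latticeLap d u x = 0)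
    (a x : Fin d → ℤ) : latticeLap d (fwdDiff a u) x = 0 := by
  have h1 := latticeLap_comp_add hu a x
  have h2 := hu x
  simp only [latticeLap, latticeAvg, fwdDiff, Finset.sum_sub_distrib] at *
  linarith

lemma latticeAvg_sq_sub_sq (hd : 1 ≤ d) {u : (Fin d → ℤ) → ℝ}
    (hu : ∀ x, latticeLap d u x = 0) :
    latticeAvg d (fun y => u y ^ 2) - (fun y => u y ^ 2) =
      (1 / (2 * (d : ℝ))) • ∑ s, fun y => fwdDiff (latticeGen d s) u y ^ 2 := by
  have hd' : (0 : ℝ) < d := by exact_mod_cast hd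
  funext x
  have h : latticeAvg d u x = u x := sub_eq_zero.mp (hu x)
  have hsum : ∑ s : Fin d × Bool, u (x + latticeGen d s) = 2 * d * u x := by
    rw [← h, latticeAvg]
    field_simp
  have hexp : ∑ s : Fin d × Bool, fwdDiff (latticeGen d s) u x ^ 2 =
      ∑ s : Fin d × Bool, u (x + latticeGen d s) ^ 2 - 2 * d * u x ^ 2 := by
    simp only [fwdDiff, sub_sq, Finset.sum_add_distrib, Finset.sum_sub_distrib]
    rw [← Finset.sum_mul, ← Finset.mul_sum, hsum]
    simp
    ring
  simp only [Pi.sub_apply, Pi.smul_apply, Finset.sum_apply, smul_eq_mul, hexp, latticeAvg]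
  field_simp

end Averaging

section GrowthFunction

variable {d : ℕ}

lemma growthQ_nonneg (u : (Fin d → ℤ) → ℝ) (n : ℕ) : 0 ≤ growthQ d u n :=
  latticeAvg_iterate_nonneg (fun _ => sq_nonneg _) n 0

lemma fwdDiff_growthQ (hd : 1 ≤ d) {u : (Fin d → ℤ) → ℝ} (hu : ∀ x, latticeLap d u x = 0) :
    fwdDiff 1 (growthQ d u) =
      (1 / (2 * (d : ℝ))) • ∑ s, growthQ d (fwdDiff (latticeGen d s) u) := by
  funext n
  simp only [fwdDiff, growthQ]
  rw [Function.iterate_succ_apply, latticeAvg_iterate, latticeAvg_iterate, ← Pi.sub_apply,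
    ← map_sub, latticeAvg_sq_sub_sq hd hu, map_smul, map_sum]
  simp [growthQ, latticeAvg_iterate]

lemma fwdDiff_iter_succ_growthQ (hd : 1 ≤ d) {u : (Fin d → ℤ) → ℝ}
    (hu : ∀ x, latticeLap d u x = 0) (k n : ℕ) :
    (fwdDiff 1)^[k + 1] (growthQ d u) n =
      (1 / (2 * (d : ℝ))) *
        ∑ s, (fwdDiff 1)^[k] (growthQ d (fwdDiff (latticeGen d s) u)) n := by
  rw [Function.iterate_succ_apply, fwdDiff_growthQ hd hu, fwdDiff_iter_const_smul,
    fwdDiff_iter_finsetSum]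
  simp

lemma fwdDiff_iter_growthQ_nonneg (hd : 1 ≤ d) {u : (Fin d → ℤ) → ℝ}
    (hu : ∀ x, latticeLap d u x = 0) (k n : ℕ) : 0 ≤ (fwdDiff 1)^[k] (growthQ d u) n := by
  induction k generalizing u with
  | zero => exact growthQ_nonneg u n
  | succ k ih =>
    rw [fwdDiff_iter_succ_growthQ hd hu]
    exact mul_nonneg (by positivity) (Finset.sum_nonneg fun s _ => ih (latticeLap_fwdDiff hu _))

lemma le_fwdDiff_iter_growthQ (hd : 1 ≤ d) {u : (Fin d → ℤ) → ℝ}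
    (hu : ∀ x, latticeLap d u x = 0) (s : Fin d × Bool) (k : ℕ) :
    (1 / (2 * (d : ℝ))) ^ k * ((fwdDiff (latticeGen d s))^[k] u 0) ^ 2 ≤
      (fwdDiff 1)^[k] (growthQ d u) 0 := by
  induction k generalizing u with
  | zero => simp [growthQ]
  | succ k ih =>
    rw [fwdDiff_iter_succ_growthQ hd hu, pow_succ', mul_assoc, Function.iterate_succ_apply]
    refine mul_le_mul_of_nonneg_left ((ih (latticeLap_fwdDiff hu _)).trans ?_) (by positivity)
    exact Finset.single_le_sum
      (f := fun s => (fwdDiff 1)^[k] (growthQ d (fwdDiff (latticeGen d s) u)) 0)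
      (fun s _ => fwdDiff_iter_growthQ_nonneg hd (latticeLap_fwdDiff hu _) k 0)
      (Finset.mem_univ s)

lemma growthQ_le (hd : 1 ≤ d) {u : (Fin d → ℤ) → ℝ} {K : ℝ} {M : ℕ}
    (hK : ∀ x, |u x| ≤ K * (1 + (latticeNorm x : ℝ)) ^ M) (n : ℕ) :
    growthQ d u n ≤ (K * (1 + (n : ℝ)) ^ M) ^ 2 := by
  have hK0 : 0 ≤ K := nonneg_of_abs_le_mul_latticeNorm hK
  refine latticeAvg_iterate_le hd n 0 fun y hy => ?_
  have h0 : (0 : ℝ) ≤ latticeNorm y := by exact_mod_cast latticeNorm_nonneg y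
  have hn : (latticeNorm y : ℝ) ≤ n := by
    have : latticeNorm y ≤ n := by simpa [latticeNorm] using hy
    exact_mod_cast this
  rw [← sq_abs]
  gcongr
  exact (hK y).trans (by gcongr)

/-- A sequence with nonnegative forward differences at `0` bounded by a polynomial of degree less
than `k` has vanishing `k`-th difference at `0`. -/
lemma fwdDiff_iter_eq_zero_of_le_pow {g : ℕ → ℝ} {M k : ℕ} {B : ℝ}
    (hg : ∀ j, 0 ≤ (fwdDiff 1)^[j] g 0) (hB : ∀ n : ℕ, g n ≤ B * (1 + (n : ℝ)) ^ M)
    (hk : M < k) : (fwdDiff 1)^[k] g 0 = 0 := by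
  refine le_antisymm ?_ (hg k)
  set c := (fwdDiff 1)^[k] g 0 with hc
  have hB0 : 0 ≤ B := by simpa using (hg 0).trans (hB 0)
  have key : ∀ m : ℕ, 1 ≤ m → m * c ≤ k.factorial * (B * (1 + (k : ℝ)) ^ M) := by
    intro m hm
    have hm' : (1 : ℝ) ≤ m := by exact_mod_cast hm
    have hnewton : ((m + k - 1).choose k : ℝ) * c ≤ g (m + k - 1) := by
      have h := shift_eq_sum_fwdDiff_iter (1 : ℕ) g (m + k - 1) 0
      simp only [zero_add, smul_eq_mul, mul_one, nsmul_eq_mul] at h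
      rw [h]
      exact Finset.single_le_sum
        (f := fun j => ((m + k - 1).choose j : ℝ) * (fwdDiff 1)^[j] g 0)
        (fun j _ => mul_nonneg (by positivity) (hg j)) (Finset.mem_range.mpr (by omega))
    have hchoose := Nat.pow_le_choose (α := ℝ) k (m + k - 1)
    rw [show m + k - 1 + 1 - k = m by omega, div_le_iff₀ (by positivity)] at hchoose
    have hup : g (m + k - 1) ≤ B * (1 + (k : ℝ)) ^ M * (m : ℝ) ^ M := by
      refine (hB _).trans ?_
      rw [mul_assoc, ← mul_pow]
      have : ((m + k - 1 : ℕ) : ℝ) = m + k - 1 := by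
        rw [Nat.cast_sub (by omega)]
        push_cast
        ring
      rw [this]
      have hk0 : (0 : ℝ) ≤ k := by positivity
      gcongr
      · linarith
      · nlinarith
    have hpow : (m : ℝ) ^ M * (m * c) ≤ (m : ℝ) ^ M * (k.factorial * (B * (1 + (k : ℝ)) ^ M)) := by
      calc (m : ℝ) ^ M * (m * c) = (m : ℝ) ^ (M + 1) * c := by ring
        _ ≤ (m : ℝ) ^ k * c :=
            mul_le_mul_of_nonneg_right (pow_le_pow_right₀ hm' hk) (hg k)
        _ ≤ ((m + k - 1).choose k * k.factorial) * c :=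
            mul_le_mul_of_nonneg_right hchoose (hg k)
        _ = k.factorial * ((m + k - 1).choose k * c) := by ring
        _ ≤ k.factorial * (B * (1 + (k : ℝ)) ^ M * (m : ℝ) ^ M) :=
            mul_le_mul_of_nonneg_left (hnewton.trans hup) (by positivity)
        _ = _ := by ring
    exact le_of_mul_le_mul_left hpow (by positivity)
  by_contra! hpos
  obtain ⟨m, hm⟩ := exists_nat_gt (k.factorial * (B * (1 + (k : ℝ)) ^ M) / c)
  rw [div_lt_iff₀ hpos] at hm
  have h := key (m + 1) (by omega)
  push_cast at h
  linarith

lemma fwdDiff_iter_eq_zero_of_growth (hd : 1 ≤ d) {u : (Fin d → ℤ) → ℝ}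
    (hu : ∀ x, latticeLap d u x = 0) {K : ℝ} {M : ℕ}
    (hK : ∀ x, |u x| ≤ K * (1 + (latticeNorm x : ℝ)) ^ M) (s : Fin d × Bool) :
    (fwdDiff (latticeGen d s))^[2 * M + 1] u = 0 := by
  have hK0 : 0 ≤ K := nonneg_of_abs_le_mul_latticeNorm hK
  funext a
  set v : (Fin d → ℤ) → ℝ := fun x => u (x + a) with hv
  have hvh : ∀ x, latticeLap d v x = 0 := latticeLap_comp_add hu a
  have hvK : ∀ x, |v x| ≤ K * (1 + (latticeNorm a : ℝ)) ^ M * (1 + (latticeNorm x : ℝ)) ^ M := by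
    intro x
    have hx : (0 : ℝ) ≤ latticeNorm x := by exact_mod_cast latticeNorm_nonneg x
    have ha : (0 : ℝ) ≤ latticeNorm a := by exact_mod_cast latticeNorm_nonneg a
    have hxa0 : (0 : ℝ) ≤ latticeNorm (x + a) := by exact_mod_cast latticeNorm_nonneg (x + a)
    have hxa : (latticeNorm (x + a) : ℝ) ≤ latticeNorm x + latticeNorm a := by
      exact_mod_cast latticeNorm_add_le x a
    refine (hK (x + a)).trans ?_
    rw [mul_assoc, ← mul_pow]
    gcongr
    nlinarith
  have hzero : (fwdDiff 1)^[2 * M + 1] (growthQ d v) 0 = 0 := by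
    refine fwdDiff_iter_eq_zero_of_le_pow (M := 2 * M)
      (B := (K * (1 + (latticeNorm a : ℝ)) ^ M) ^ 2)
      (fun j => fwdDiff_iter_growthQ_nonneg hd hvh j 0) (fun n => ?_) (by omega)
    refine (growthQ_le hd hvK n).trans_eq ?_
    ring
  have hle := le_fwdDiff_iter_growthQ hd hvh s (2 * M + 1)
  rw [hzero, hv, fwdDiff_iter_comp_add, zero_add] at hle
  have hd' : (0 : ℝ) < d := by exact_mod_cast hd
  have hsq := nonpos_of_mul_nonpos_right hle (by positivity)
  simpa using le_antisymm hsq (sq_nonneg _)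

end GrowthFunction

section Interpolation

lemma eq_zero_of_fwdDiff_iter_eq_zero {N : ℕ} {g : ℤ → ℝ} (hg : (fwdDiff 1)^[N] g = 0)
    (h0 : ∀ j < N, g (j : ℤ) = 0) : g = 0 := by
  induction N generalizing g with
  | zero => simpa using hg
  | succ N ih =>
    have hdiff : fwdDiff 1 g = 0 := by
      refine ih (by simpa using hg) fun j hj => ?_
      have h1 := h0 (j + 1) (by omega)
      push_cast at h1
      simp [fwdDiff, h1, h0 j (by omega)]
    have hstep : ∀ n, g (n + 1) = g n := fun n => sub_eq_zero.mp (congrFun hdiff n)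
    have hg0 : g 0 = 0 := by simpa using h0 0 (by omega)
    funext n
    change g n = 0
    induction n with
    | zero => exact hg0
    | succ n ihn => rw [hstep, ihn]
    | pred n ihn => rw [← ihn, ← hstep, sub_add_cancel]

lemma fwdDiff_iter_intCast_polynomial {q : Polynomial ℝ} {N : ℕ} (hq : q.natDegree < N) :
    (fwdDiff (1 : ℤ))^[N] (fun n : ℤ => q.eval (n : ℝ)) = 0 := by
  funext n
  have h := congrFun (Polynomial.fwdDiff_iter_eq_zero_of_degree_lt hq) (n : ℝ)
  rw [fwdDiff_iter_eq_sum_shift] at h ⊢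
  simpa using h

lemma eq_sum_basis_of_fwdDiff_iter_eq_zero {N : ℕ} {g : ℤ → ℝ} (hg : (fwdDiff 1)^[N] g = 0)
    (n : ℤ) :
    g n = ∑ j ∈ Finset.range N,
      g (j : ℤ) * (Lagrange.basis (Finset.range N) (fun j : ℕ => (j : ℝ)) j).eval (n : ℝ) := by
  have hinj : Set.InjOn (fun j : ℕ => (j : ℝ)) (Finset.range N) := Nat.cast_injective.injOn
  set q := Lagrange.interpolate (Finset.range N) (fun j : ℕ => (j : ℝ)) (fun j => g (j : ℤ))
    with hq
  have hqn : (fwdDiff (1 : ℤ))^[N] (fun n : ℤ => q.eval (n : ℝ)) = 0 := by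
    rcases Nat.eq_zero_or_pos N with rfl | hN
    · funext n
      simp [hq]
    · have hdeg : q.degree < N := by
        simpa [hq] using Lagrange.degree_interpolate_lt (fun j : ℕ => g (j : ℤ)) hinj
      refine fwdDiff_iter_intCast_polynomial ?_
      rcases eq_or_ne q 0 with h0 | h0
      · simpa [h0] using hN
      · exact (Polynomial.natDegree_lt_iff_degree_lt h0).mpr hdeg
  have hzero : g - (fun n : ℤ => q.eval (n : ℝ)) = 0 := by
    refine eq_zero_of_fwdDiff_iter_eq_zero (N := N) ?_ fun j hj => ?_
    · rw [sub_eq_add_neg, ← neg_one_smul ℝ, fwdDiff_iter_add, fwdDiff_iter_const_smul, hg, hqn]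
      simp
    · have := Lagrange.eval_interpolate_at_node (fun j : ℕ => g (j : ℤ)) hinj
        (Finset.mem_range.mpr hj)
      simp only [Pi.sub_apply, Int.cast_natCast, sub_eq_zero]
      exact this.symm
  have := congrFun (sub_eq_zero.mp hzero) n
  rw [this, hq, Lagrange.interpolate_apply, Polynomial.eval_finsetSum]
  simp

variable {d : ℕ}

lemma exists_mvPolynomial_of_fwdDiff_iter_eq_zero (N : ℕ) (S : Finset (Fin d))
    (v : (Fin d → ℤ) → ℝ) (hS : ∀ x y, (∀ i ∈ S, x i = y i) → v x = v y)
    (hv : ∀ i x, (fwdDiff (1 : ℤ))^[N] (fun n => v (Function.update x i n)) = 0) :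
    ∃ p : MvPolynomial (Fin d) ℝ, ∀ x, v x = MvPolynomial.eval (fun i => (x i : ℝ)) p := by
  induction S using Finset.induction_on generalizing v with
  | empty => exact ⟨MvPolynomial.C (v 0), fun x => by simpa using hS x 0 (by simp)⟩
  | insert i S hi ih =>
    have hp : ∀ j : ℕ, ∃ p : MvPolynomial (Fin d) ℝ, ∀ x,
        v (Function.update x i (j : ℤ)) = MvPolynomial.eval (fun i => (x i : ℝ)) p := by
      intro j
      refine ih (fun x => v (Function.update x i (j : ℤ))) ?_ ?_
      · refine fun x y hxy => hS _ _ fun k hk => ?_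
        rcases eq_or_ne k i with rfl | hki
        · simp
        · simpa [hki] using hxy k (Finset.mem_of_mem_insert_of_ne hk hki)
      · intro k x
        rcases eq_or_ne k i with rfl | hki
        · rcases Nat.eq_zero_or_pos N with rfl | hN
          · funext n
            simpa using congrFun (hv k x) j
          · simp only [Function.update_idem]
            have := fwdDiff_iter_intCast_polynomial (N := N)
              (q := Polynomial.C (v (Function.update x k (j : ℤ)))) (by simpa using hN)
            simpa using this
        · simp only [Function.update_comm hki]
          exact hv k _
    choose p hp using hp
    refine ⟨∑ j ∈ Finset.range N, p j * Polynomial.aeval (MvPolynomial.X i)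
      (Lagrange.basis (Finset.range N) (fun j : ℕ => (j : ℝ)) j), fun x => ?_⟩
    have h := eq_sum_basis_of_fwdDiff_iter_eq_zero (hv i x) (x i)
    simp only [Function.update_eq_self] at h
    rw [h, map_sum]
    refine Finset.sum_congr rfl fun j _ => ?_
    rw [map_mul, hp, ← MvPolynomial.coe_aeval_eq_eval, RingHom.coe_coe,
      ← Polynomial.aeval_algHom_apply]
    simp

end Interpolation

section Degree

variable {d : ℕ}

lemma MvPolynomial.IsHomogeneous.eval_mul_left {σ R : Type*} [CommSemiring R] {n : ℕ}
    {φ : MvPolynomial σ R} (hφ : φ.IsHomogeneous n) (t : R) (z : σ → R) :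
    MvPolynomial.eval (fun i => t * z i) φ = t ^ n * MvPolynomial.eval z φ := by
  rw [MvPolynomial.eval_eq, MvPolynomial.eval_eq, Finset.mul_sum]
  refine Finset.sum_congr rfl fun m hm => ?_
  have hdeg : ∑ i ∈ m.support, m i = n := by
    rw [← hφ (MvPolynomial.mem_support_iff.mp hm), Finsupp.weight_apply]
    simp [Finsupp.sum]
  simp only [mul_pow, Finset.prod_mul_distrib, Finset.prod_pow_eq_pow_sum, hdeg]
  ring

lemma totalDegree_le_of_growth {p : MvPolynomial (Fin d) ℝ} {K : ℝ} {M : ℕ}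
    (hK : ∀ x : Fin d → ℤ, |MvPolynomial.eval (fun i => (x i : ℝ)) p| ≤
      K * (1 + (latticeNorm x : ℝ)) ^ M) : p.totalDegree ≤ M := by
  by_contra! hM
  have hK0 : 0 ≤ K := nonneg_of_abs_le_mul_latticeNorm hK
  set N := p.totalDegree
  have htop : MvPolynomial.homogeneousComponent N p ≠ 0 := by
    have hp : p.support.Nonempty := by
      rw [MvPolynomial.support_nonempty]
      rintro rfl
      simp [N] at hM
    obtain ⟨m, hm, hmN⟩ := Finset.exists_mem_eq_sup p.support hp fun s => s.sum fun _ e => e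
    have hcoeff := MvPolynomial.coeff_homogeneousComponent N p m
    rw [if_pos (show m.degree = N from hmN.symm)] at hcoeff
    intro h0
    rw [h0, MvPolynomial.coeff_zero] at hcoeff
    exact MvPolynomial.mem_support_iff.mp hm hcoeff.symm
  obtain ⟨z, hz⟩ : ∃ z : Fin d → ℤ,
      MvPolynomial.eval (fun i => (z i : ℝ)) (MvPolynomial.homogeneousComponent N p) ≠ 0 := by
    by_contra! h
    refine htop (MvPolynomial.funext_set (fun _ => Set.range ((↑) : ℤ → ℝ))
      (fun _ => Set.infinite_range_of_injective Int.cast_injective) fun x hx => ?_)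
    choose z hz using fun i => hx i (Set.mem_univ i)
    obtain rfl : (fun i => (z i : ℝ)) = x := funext hz
    simpa using h z
  set q : Polynomial ℝ := ∑ k ∈ Finset.range (N + 1), Polynomial.C
    (MvPolynomial.eval (fun i => (z i : ℝ)) (MvPolynomial.homogeneousComponent k p)) *
      Polynomial.X ^ k with hq
  have heval : ∀ t : ℕ, q.eval (t : ℝ) =
      MvPolynomial.eval (fun i => (((t • z) i : ℤ) : ℝ)) p := by
    intro t
    conv_rhs => rw [← MvPolynomial.sum_homogeneousComponent p]
    simp only [hq, Polynomial.eval_finsetSum, map_sum]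
    refine Finset.sum_congr rfl fun k _ => ?_
    have := (MvPolynomial.homogeneousComponent_isHomogeneous k p).eval_mul_left (t : ℝ)
      (fun i => (z i : ℝ))
    simp only [Polynomial.eval_mul, Polynomial.eval_C, Polynomial.eval_pow, Polynomial.eval_X]
    rw [mul_comm, ← this]
    simp
  have hcoeff : q.coeff N ≠ 0 := by
    simpa [hq, Polynomial.finsetSum_coeff, Polynomial.coeff_C_mul, Polynomial.coeff_X_pow] using hz
  have hdeg : (Polynomial.X ^ M : Polynomial ℝ).degree < q.degree := by
    rw [Polynomial.degree_X_pow]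
    exact lt_of_lt_of_le (by exact_mod_cast hM) (Polynomial.le_degree_of_ne_zero hcoeff)
  have htend := (Polynomial.abs_div_tendsto_atTop_atTop_of_degree_gt q (Polynomial.X ^ M) hdeg
    (by simp)).comp (tendsto_natCast_atTop_atTop (R := ℝ))
  obtain ⟨t, ht, ht1⟩ := ((htend.eventually_gt_atTop
    (K * (1 + (latticeNorm z : ℝ)) ^ M)).and (Filter.eventually_ge_atTop 1)).exists
  have ht1' : (1 : ℝ) ≤ t := by exact_mod_cast ht1
  have hz0 : (0 : ℝ) ≤ latticeNorm z := by exact_mod_cast latticeNorm_nonneg z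
  have hbound := hK (t • z)
  rw [← heval, latticeNorm_nsmul] at hbound
  simp only [Function.comp_apply, Polynomial.eval_pow, Polynomial.eval_X, abs_div] at ht
  rw [abs_of_pos (show (0 : ℝ) < (t : ℝ) ^ M by positivity), lt_div_iff₀ (by positivity)] at ht
  refine absurd (ht.trans_le hbound) (not_lt.mpr ?_)
  rw [mul_assoc, ← mul_pow]
  push_cast
  gcongr
  nlinarith

end Degree

theorem stmt_7 (d : ℕ) (hd : 1 ≤ d) (M : ℕ) (u : (Fin d → ℤ) → ℝ)
    (hu : ∀ x, latticeLap d u x = 0)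
    (hgrowth : ∃ C D : ℝ, 0 < C ∧ 0 < D ∧
      ∀ x : Fin d → ℤ, |u x| ≤ C * ((∑ i, |x i| : ℤ) : ℝ) ^ M + D) :
    ∃ p : MvPolynomial (Fin d) ℝ, p.totalDegree ≤ M ∧
      ∀ x : Fin d → ℤ, u x = MvPolynomial.eval (fun i => ((x i : ℝ))) p := by
  obtain ⟨C, D, hC, hD, hCD⟩ := hgrowth
  have hK : ∀ x, |u x| ≤ (C + D) * (1 + (latticeNorm x : ℝ)) ^ M := by
    intro x
    have hx : (0 : ℝ) ≤ latticeNorm x := by exact_mod_cast latticeNorm_nonneg x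
    have h1 : (latticeNorm x : ℝ) ^ M ≤ (1 + (latticeNorm x : ℝ)) ^ M := by
      gcongr
      linarith
    have h2 : (1 : ℝ) ≤ (1 + (latticeNorm x : ℝ)) ^ M := one_le_pow₀ (by linarith)
    calc |u x| ≤ C * (latticeNorm x : ℝ) ^ M + D := hCD x
      _ ≤ C * (1 + (latticeNorm x : ℝ)) ^ M + D * (1 + (latticeNorm x : ℝ)) ^ M :=
          add_le_add (by gcongr) (le_mul_of_one_le_right hD.le h2)
      _ = _ := by ring
  obtain ⟨p, hp⟩ := exists_mvPolynomial_of_fwdDiff_iter_eq_zero (2 * M + 1) Finset.univ u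
    (fun x y h => congrArg u (funext fun i => h i (Finset.mem_univ i))) (fun i x => by
      rw [fwdDiff_iter_update, fwdDiff_iter_eq_zero_of_growth hd hu hK]
      rfl)
  exact ⟨p, totalDegree_le_of_growth fun x => hp x ▸ hK x, hp⟩
end
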